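/- arXiv:1401.3143 — 2 statements merged into one kernel-verified Lean document; each statement's English description precedes it below -/
import Mathlib

section
/- For every twice continuously differentiable function f : ℝ → ℂ with compact support contained in (0,∞), the half-Hartley transform H₊f satisfies the lower norm bound ‖H₊f‖_{L²(0,∞)} ≥ √2 ‖f‖_{L²(0,∞)}. -/
open MeasureTheory Set Filter
open scoped Real

/-- The half-Hartley transform of `f`. -/
noncomputable def halfHartley (f : ℝ → ℂ) (x : ℝ) : ℂ :=
  (Real.sqrt (2 / π) : ℂ) *
    ∫ t in Ioi (0 : ℝ), ((Real.cos (x * t) + Real.sin (x * t) : ℝ) : ℂ) * f t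

open FourierTransform in
lemma hh_integrable_fourier (f : ℝ → ℂ) (hf : ContDiff ℝ 2 f) (hsupp : HasCompactSupport f) :
    Integrable (𝓕 f) := by
  have hint : Integrable f := hf.continuous.integrable_of_hasCompactSupport hsupp
  have hcont : Continuous (𝓕 f) :=
    VectorFourier.fourierIntegral_continuous Real.continuous_fourierChar
      (by exact continuous_inner) hint
  have hI : ∀ n : ℕ, (n : ℕ∞) ≤ (2 : ℕ∞) → Integrable (iteratedDeriv n f) := by
    intro n hn
    have hc : Continuous (iteratedDeriv n f) :=
      hf.continuous_iteratedDeriv n (by exact_mod_cast hn)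
    refine hc.integrable_of_hasCompactSupport ?_
    rw [iteratedDeriv_eq_equiv_comp]
    exact (hsupp.iteratedFDeriv n).comp_left (by simp)
  have h2 := Real.fourier_iteratedDeriv (f := f) (N := 2) (n := 2) (by exact_mod_cast hf) hI
    (by norm_num)
  have hb0 : ∀ x, ‖𝓕 f x‖ ≤ ∫ t, ‖f t‖ := fun x =>
    VectorFourier.norm_fourierIntegral_le_integral_norm _ _ _ _ _
  have hb2 : ∀ x, ‖𝓕 (iteratedDeriv 2 f) x‖ ≤ ∫ t, ‖iteratedDeriv 2 f t‖ := fun x =>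
    VectorFourier.norm_fourierIntegral_le_integral_norm _ _ _ _ _
  refine Integrable.mono' (g := fun x : ℝ => ((∫ t, ‖f t‖) + ∫ t, ‖iteratedDeriv 2 f t‖) *
    (1 + x ^ 2)⁻¹) (integrable_inv_one_add_sq.const_mul _) hcont.aestronglyMeasurable ?_
  refine Eventually.of_forall fun x => ?_
  have h0 := hb0 x
  have h3 := hb2 x
  rw [h2] at h3
  simp only [norm_smul, norm_pow, norm_mul, Complex.norm_I, Complex.norm_real, Complex.norm_ofNat,
    Real.norm_eq_abs, abs_of_pos Real.pi_pos, mul_pow, sq_abs] at h3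
  have hpi : 1 ≤ (2 : ℝ) ^ 2 * π ^ 2 := by nlinarith [Real.pi_gt_three]
  have hF := norm_nonneg (𝓕 f x)
  rw [← div_eq_mul_inv, le_div_iff₀ (by positivity)]
  nlinarith [mul_nonneg (mul_nonneg (sq_nonneg x) hF) (sub_nonneg.2 hpi)]

open FourierTransform in
lemma hh_plancherel (f : ℝ → ℂ) (hf : ContDiff ℝ 2 f) (hsupp : HasCompactSupport f) :
    ∫ x, ‖𝓕 f x‖ ^ 2 = ∫ x, ‖f x‖ ^ 2 := by
  have hint : Integrable f := hf.continuous.integrable_of_hasCompactSupport hsupp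
  have hF := hh_integrable_fourier f hf hsupp
  have hinv := hf.continuous.fourierInv_fourier_eq hint hF
  have h := VectorFourier.integral_sesq_fourierIntegral_eq_neg_flip (innerSL ℂ (E := ℂ))
    (L := innerₗ ℝ) Real.continuous_fourierChar (by exact continuous_inner) hint hF
  have h' : ∫ ξ, inner ℂ (𝓕 f ξ) (𝓕 f ξ) = ∫ x, inner ℂ (f x) (f x) := by
    conv_rhs => enter [2, x]; rw [← hinv, hinv]
    rw [flip_innerₗ] at h
    have h3 : ∀ x, VectorFourier.fourierIntegral Real.fourierChar volume (-innerₗ ℝ) (𝓕 f) x = f x :=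
      fun x => congrFun hinv x
    simp only [h3] at h
    exact h
  apply Complex.ofRealLI.injective
  simpa [← LinearIsometry.integral_comp_comm, inner_self_eq_norm_sq_to_K] using h'

/-- The two-parameter exponential transform. -/
noncomputable def hhT (f : ℝ → ℂ) (w : ℂ) (x : ℝ) : ℂ :=
  ∫ t : ℝ, Complex.exp (-(w * x * t)) * f t

open FourierTransform in
lemma hhT_eq (f : ℝ → ℂ) (x : ℝ) : hhT f (-Complex.I) x = 𝓕 f (x * (-(2 * π)⁻¹)) := by
  rw [Real.fourier_real_eq_integral_exp_smul, hhT]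
  congr 1 with t
  rw [smul_eq_mul]
  congr 2
  have := Real.pi_ne_zero
  push_cast
  have : (π : ℂ) ≠ 0 := by exact_mod_cast this
  field_simp

lemma hhT_integrable (f : ℝ → ℂ) (hf : ContDiff ℝ 2 f) (hsupp : HasCompactSupport f) :
    Integrable (hhT f (-Complex.I)) := by
  have h := (hh_integrable_fourier f hf hsupp).comp_mul_right' (R := -(2 * π)⁻¹)
    (by have := Real.pi_pos; simp [this.ne'])
  refine h.congr (Eventually.of_forall fun x => ?_)
  exact (hhT_eq f x).symm

lemma hhT_plancherel (f : ℝ → ℂ) (hf : ContDiff ℝ 2 f) (hsupp : HasCompactSupport f) :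
    ∫ x, ‖hhT f (-Complex.I) x‖ ^ 2 = 2 * π * ∫ x, ‖f x‖ ^ 2 := by
  simp only [hhT_eq]
  rw [Measure.integral_comp_mul_right (fun y => ‖FourierTransform.fourier f y‖ ^ 2),
    hh_plancherel f hf hsupp]
  have := Real.pi_pos
  simp [abs_of_pos this]

lemma hhT_bdd (f : ℝ → ℂ) (x : ℝ) : ‖hhT f (-Complex.I) x‖ ≤ ∫ t, ‖f t‖ := by
  rw [hhT_eq]
  exact VectorFourier.norm_fourierIntegral_le_integral_norm _ _ _ _ _

lemma hh_fubini (f g : ℝ → ℂ) (hf : Integrable f) (hg : Integrable g) (hfc : Continuous f)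
    (hgc : Continuous g) (a : ℝ) (hfa : ∀ t < a, f t = 0) (hga : ∀ t < a, g t = 0)
    (ε : ℝ) (w : ℂ) (hw : 0 ≤ w.re) (hpos : 0 < ε + 2 * a * w.re) :
    ∫ x in Ioi (0 : ℝ), Complex.exp (-(ε * x)) * (hhT f w x * hhT g w x) =
      ∫ p : ℝ × ℝ, f p.1 * g p.2 * ((ε : ℂ) + w * (p.1 + p.2))⁻¹ := by
  set K : ℝ → ℝ × ℝ → ℂ := fun x p => Complex.exp (-(ε * x)) *
    ((Complex.exp (-(w * x * p.1)) * f p.1) * (Complex.exp (-(w * x * p.2)) * g p.2)) with hK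
  have hKint : Integrable (Function.uncurry K)
      ((volume.restrict (Ioi (0 : ℝ))).prod (volume.prod volume)) := by
    have hb : Integrable (fun z : ℝ × (ℝ × ℝ) => Real.exp (-(ε + 2 * a * w.re) * z.1) *
        (‖f z.2.1‖ * ‖g z.2.2‖))
        ((volume.restrict (Ioi (0 : ℝ))).prod (volume.prod volume)) := by
      have h1 : Integrable (fun x : ℝ => Real.exp (-(ε + 2 * a * w.re) * x))
          (volume.restrict (Ioi (0 : ℝ))) := integrableOn_exp_mul_Ioi (by linarith) 0
      exact h1.mul_prod (hf.norm.mul_prod hg.norm)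
    refine hb.mono' ?_ ?_
    · apply Continuous.aestronglyMeasurable
      simp only [hK, Function.uncurry_def]
      fun_prop
    · have hx : ∀ᵐ z ∂((volume.restrict (Ioi (0 : ℝ))).prod
          ((volume : Measure ℝ).prod (volume : Measure ℝ))), 0 < z.1 :=
        Measure.quasiMeasurePreserving_fst.ae (ae_restrict_mem measurableSet_Ioi)
      filter_upwards [hx] with z hz
      obtain ⟨x, t, s⟩ := z
      simp only [hK, Function.uncurry_def] at hz ⊢
      by_cases ht : t < a
      · simp [hfa t ht]
      by_cases hs : s < a
      · simp [hga s hs]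
      push Not at ht hs
      simp only [norm_mul, Complex.norm_exp]
      have h2 : (-(ε * x : ℂ)).re = -(ε * x) := by simp
      have h3 : ∀ r : ℝ, (-(w * x * r : ℂ)).re = -(w.re * x * r) := by intro r; simp
      rw [h2, h3, h3]
      have : Real.exp (-(ε * x)) * (Real.exp (-(w.re * x * t)) * ‖f t‖ *
          (Real.exp (-(w.re * x * s)) * ‖g s‖)) =
          Real.exp (-(ε * x) + -(w.re * x * t) + -(w.re * x * s)) * (‖f t‖ * ‖g s‖) := by
        rw [Real.exp_add, Real.exp_add]; ring
      rw [this]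
      gcongr
      have hwx := mul_nonneg hw hz.le
      nlinarith [mul_nonneg hwx (sub_nonneg.2 ht), mul_nonneg hwx (sub_nonneg.2 hs)]
  have hswap := integral_integral_swap hKint
  have hL : ∀ x, ∫ p, K x p ∂(volume.prod volume) =
      Complex.exp (-(ε * x)) * (hhT f w x * hhT g w x) := by
    intro x
    simp only [hK]
    rw [integral_const_mul]
    congr 1
    exact integral_prod_mul (fun t : ℝ => Complex.exp (-(w * x * t)) * f t)
      (fun t : ℝ => Complex.exp (-(w * x * t)) * g t)
  have hR : ∀ p : ℝ × ℝ, ∫ x in Ioi (0 : ℝ), K x p =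
      f p.1 * g p.2 * ((ε : ℂ) + w * (p.1 + p.2))⁻¹ := by
    rintro ⟨t, s⟩
    simp only [hK]
    by_cases ht : t < a
    · simp [hfa t ht]
    by_cases hs : s < a
    · simp [hga s hs]
    push Not at ht hs
    have hre : (-((ε : ℂ) + w * (t + s))).re < 0 := by
      simp
      nlinarith [mul_nonneg hw (sub_nonneg.2 ht), mul_nonneg hw (sub_nonneg.2 hs)]
    have hi := integral_exp_mul_complex_Ioi hre 0
    simp only [Complex.ofReal_zero, mul_zero, Complex.exp_zero, neg_div_neg_eq, one_div] at hi
    rw [← hi, ← integral_const_mul]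
    congr 1 with x
    have : Complex.exp (-((ε : ℂ) + w * (t + s)) * x) = Complex.exp (-(ε * x)) *
        Complex.exp (-(w * x * t)) * Complex.exp (-(w * x * s)) := by
      rw [← Complex.exp_add, ← Complex.exp_add]; congr 1; ring
    rw [this]; ring
  simp only [hL, hR] at hswap
  exact hswap

lemma hhT_conj (f : ℝ → ℂ) (w : ℂ) (x : ℝ) :
    hhT (fun t => starRingEnd ℂ (f t)) w x = starRingEnd ℂ (hhT f (starRingEnd ℂ w) x) := by
  rw [hhT, hhT, ← integral_conj]
  congr 1 with t
  simp [← Complex.exp_conj]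

lemma hh_key (f g : ℝ → ℂ) (hf : Integrable f) (hg : Integrable g) (hfc : Continuous f)
    (hgc : Continuous g) (a : ℝ) (ha : 0 < a) (hfa : ∀ t < a, f t = 0) (hga : ∀ t < a, g t = 0)
    (hG : Integrable (fun x => hhT f (-Complex.I) x * hhT g (-Complex.I) x)) :
    ∫ x in Ioi (0 : ℝ), hhT f (-Complex.I) x * hhT g (-Complex.I) x =
      Complex.I * ∫ x in Ioi (0 : ℝ), hhT f 1 x * hhT g 1 x := by
  have h1 := hh_fubini f g hf hg hfc hgc a hfa hga 0 1 (by simp) (by simpa using ha)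
  simp only [Complex.ofReal_zero, zero_mul, neg_zero, Complex.exp_zero, one_mul, zero_add] at h1
  rw [h1]
  set e : ℕ → ℝ := fun n => 1 / ((n : ℝ) + 1) with he
  have he0 : ∀ n, 0 < e n := fun n => by simp only [he]; positivity
  have het : Tendsto e atTop (nhds 0) := tendsto_one_div_add_atTop_nhds_zero_nat
  have h2 : ∀ n, ∫ x in Ioi (0 : ℝ), Complex.exp (-(e n * x)) *
      (hhT f (-Complex.I) x * hhT g (-Complex.I) x) = _ := fun n =>
    hh_fubini f g hf hg hfc hgc a hfa hga (e n) (-Complex.I) (by simp) (by simpa using he0 n)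
  have hl : Tendsto (fun n => ∫ x in Ioi (0 : ℝ), Complex.exp (-(e n * x)) *
      (hhT f (-Complex.I) x * hhT g (-Complex.I) x)) atTop
      (nhds (∫ x in Ioi (0 : ℝ), hhT f (-Complex.I) x * hhT g (-Complex.I) x)) := by
    refine tendsto_integral_of_dominated_convergence
      (fun x => ‖hhT f (-Complex.I) x * hhT g (-Complex.I) x‖) ?_ hG.norm.integrableOn ?_ ?_
    · intro n
      exact (Continuous.aestronglyMeasurable (by fun_prop)).mul hG.integrableOn.1
    · intro n
      filter_upwards [ae_restrict_mem measurableSet_Ioi] with x hx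
      rw [norm_mul]
      refine mul_le_of_le_one_left (norm_nonneg _) ?_
      rw [Complex.norm_exp]
      have : (-(e n * x : ℂ)).re = -(e n * x) := by simp
      rw [this, Real.exp_le_one_iff]
      have := mul_pos (he0 n) hx
      linarith
    · refine Eventually.of_forall fun x => ?_
      have hc : Continuous fun r : ℝ => Complex.exp (-(r * x)) *
        (hhT f (-Complex.I) x * hhT g (-Complex.I) x) := by fun_prop
      have := (hc.tendsto 0).comp het
      simpa [Function.comp_def] using this
  have hr : Tendsto (fun n => ∫ p : ℝ × ℝ, f p.1 * g p.2 *
      ((e n : ℂ) + -Complex.I * (p.1 + p.2))⁻¹) atTop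
      (nhds (∫ p : ℝ × ℝ, Complex.I * (f p.1 * g p.2 * ((p.1 : ℂ) + p.2)⁻¹))) := by
    refine tendsto_integral_of_dominated_convergence
      (fun p => ‖f p.1‖ * ‖g p.2‖ * (2 * a)⁻¹) ?_ ((hf.norm.mul_prod hg.norm).mul_const _) ?_ ?_
    · intro n
      have hm : Measurable fun p : ℝ × ℝ => f p.1 * g p.2 *
          ((e n : ℂ) + -Complex.I * (p.1 + p.2))⁻¹ := by
        have := hfc.measurable
        have := hgc.measurable
        fun_prop
      exact hm.aestronglyMeasurable
    · intro n
      refine Eventually.of_forall fun ⟨t, s⟩ => ?_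
      by_cases ht : t < a
      · simp [hfa t ht]
      by_cases hs : s < a
      · simp [hga s hs]
      push Not at ht hs
      simp only [norm_mul, norm_inv]
      gcongr
      refine le_trans ?_ (Complex.abs_im_le_norm _)
      simp
      rw [abs_of_nonpos] <;> linarith
    · refine Eventually.of_forall fun ⟨t, s⟩ => ?_
      by_cases ht : t < a
      · simp [hfa t ht]
      by_cases hs : s < a
      · simp [hga s hs]
      push Not at ht hs
      have hne : ((t : ℂ) + s) ≠ 0 := by
        have : t + s ≠ 0 := by linarith
        exact_mod_cast this
      have h3 : Tendsto (fun n => ((e n : ℂ) + -Complex.I * (t + s))) atTop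
          (nhds (((0 : ℝ) : ℂ) + -Complex.I * (t + s))) :=
        ((Complex.continuous_ofReal.tendsto 0).comp het).add_const _
      have h4 := (h3.inv₀ (by simpa using hne)).const_mul (f t * g s)
      convert h4 using 2
      simp only [Complex.ofReal_zero, zero_add, mul_inv, neg_mul, inv_neg, Complex.inv_I]
      ring
  simp only [h2] at hl
  rw [tendsto_nhds_unique hl hr, integral_const_mul]

lemma hh_int (f : ℝ → ℂ) (hf : Integrable f) (hpos : ∀ t ≤ 0, f t = 0) (x : ℝ) :
    ∫ t in Ioi (0 : ℝ), ((Real.cos (x * t) + Real.sin (x * t) : ℝ) : ℂ) * f t =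
      ((1 - Complex.I) * hhT f (-Complex.I) x + (1 + Complex.I) * hhT f (-Complex.I) (-x)) / 2 := by
  have hI : ∀ y : ℝ, Integrable (fun t : ℝ => Complex.exp (-(-Complex.I * y * t)) * f t) := by
    intro y
    refine hf.norm.mono' ((Continuous.aestronglyMeasurable (by fun_prop)).mul hf.1) ?_
    refine Eventually.of_forall fun t => ?_
    rw [norm_mul, Complex.norm_exp]
    simp
  rw [setIntegral_eq_integral_of_forall_compl_eq_zero]
  · rw [hhT, hhT, ← integral_const_mul, ← integral_const_mul, ← integral_add ((hI x).const_mul _)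
      ((hI (-x)).const_mul _), ← integral_div]
    congr 1 with t
    have e1 : -(-Complex.I * x * t) = (x * t : ℂ) * Complex.I := by ring
    have e2 : -(-Complex.I * ((-x : ℝ) : ℂ) * t) = -(x * t : ℂ) * Complex.I := by push_cast; ring
    rw [e1, e2, Complex.exp_mul_I, Complex.exp_mul_I, Complex.cos_neg, Complex.sin_neg]
    push_cast
    linear_combination (f t * Complex.sin (x * t)) * Complex.I_sq
  · intro t ht
    rw [hpos t (by simpa using ht), mul_zero]

lemma hh_normsq (A B : ℂ) : ‖((1 - Complex.I) * A + (1 + Complex.I) * B) / 2‖ ^ 2 =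
    (‖A‖ ^ 2 + ‖B‖ ^ 2) / 2 + (A * starRingEnd ℂ B).im := by
  simp only [← Complex.normSq_eq_norm_sq, Complex.normSq_apply]
  simp
  ring

/-- Lower norm bound for the half-Hartley transform of a `C²` function with
compact support in `(0, ∞)`. -/
theorem halfHartley_L2_lower_bound (f : ℝ → ℂ) (hf : ContDiff ℝ 2 f)
    (hsupp : HasCompactSupport f) (hpos : tsupport f ⊆ Ioi (0 : ℝ)) :
    Real.sqrt 2 * (∫ x in Ioi (0 : ℝ), ‖f x‖ ^ 2) ^ ((1 : ℝ) / 2) ≤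
      (∫ x in Ioi (0 : ℝ), ‖halfHartley f x‖ ^ 2) ^ ((1 : ℝ) / 2) := by
  have hint : Integrable f := hf.continuous.integrable_of_hasCompactSupport hsupp
  have hz : ∀ t ≤ 0, f t = 0 := by
    intro t ht
    by_contra h
    have := hpos (subset_tsupport f h)
    simp at this
    linarith
  obtain ⟨a, ha, hfa⟩ : ∃ a > 0, ∀ t < a, f t = 0 := by
    rcases (tsupport f).eq_empty_or_nonempty with he | hne
    · refine ⟨1, one_pos, fun t _ => image_eq_zero_of_notMem_tsupport (by simp [he])⟩
    · obtain ⟨m, hm, hmin⟩ := hsupp.isCompact.exists_isLeast hne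
      refine ⟨m, hpos hm, fun t ht => image_eq_zero_of_notMem_tsupport fun h => ?_⟩
      exact absurd (hmin h) (not_le.2 ht)
  set E := hhT f (-Complex.I) with hE
  have hEint : Integrable E := hhT_integrable f hf hsupp
  have hEb : ∀ x, ‖E x‖ ≤ ∫ t, ‖f t‖ := hhT_bdd f
  have hEint' : Integrable (fun x => E (-x)) := hEint.comp_neg
  have hE2 : Integrable (fun x => ‖E x‖ ^ 2) := by
    refine (hEint.norm.const_mul (∫ t, ‖f t‖)).mono' (hEint.1.norm.pow 2) ?_
    refine Eventually.of_forall fun x => ?_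
    rw [Real.norm_of_nonneg (by positivity), sq]
    gcongr
    exact hEb x
  have hE2' : Integrable (fun x => ‖E (-x)‖ ^ 2) := hE2.comp_neg
  set g : ℝ → ℂ := fun t => starRingEnd ℂ (f t) with hg
  have hTg : ∀ x, hhT g (-Complex.I) x = starRingEnd ℂ (E (-x)) := by
    intro x
    rw [hg, hhT_conj, hE]
    simp [hhT]
  have hG : Integrable (fun x => hhT f (-Complex.I) x * hhT g (-Complex.I) x) := by
    simp only [hTg]
    refine (hEint.norm.mul_const (∫ t, ‖f t‖)).mono'
      (hEint.1.mul (Complex.continuous_conj.comp_aestronglyMeasurable hEint'.1)) ?_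
    refine Eventually.of_forall fun x => ?_
    rw [norm_mul, RCLike.norm_conj]
    gcongr
    exact hEb _
  have hgc : Continuous g := Complex.continuous_conj.comp hf.continuous
  have hgint : Integrable g :=
    hint.norm.mono' hgc.aestronglyMeasurable (Eventually.of_forall fun t => by simp [hg])
  have hkey := hh_key f g hint hgint hf.continuous hgc a ha hfa
    (fun t ht => by simp [hg, hfa t ht]) hG
  have hIm : 0 ≤ ∫ x in Ioi (0 : ℝ), (E x * starRingEnd ℂ (E (-x))).im := by
    have h1 : ∫ x in Ioi (0 : ℝ), (E x * starRingEnd ℂ (E (-x))).im =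
        (∫ x in Ioi (0 : ℝ), hhT f (-Complex.I) x * hhT g (-Complex.I) x).im := by
      simp only [← hTg]
      exact integral_im hG.integrableOn
    have h2 : ∀ x, hhT f 1 x * hhT g 1 x = ((‖hhT f 1 x‖ ^ 2 : ℝ) : ℂ) := by
      intro x
      rw [hg, hhT_conj, map_one, Complex.mul_conj, Complex.normSq_eq_norm_sq]
    rw [h1, hkey]
    simp only [h2]
    rw [integral_complex_ofReal, Complex.I_mul_im, Complex.ofReal_re]
    exact integral_nonneg fun x => by positivity
  have hP : ∫ x in Ioi (0 : ℝ), (‖E x‖ ^ 2 + ‖E (-x)‖ ^ 2) = 2 * π * ∫ x in Ioi (0 : ℝ), ‖f x‖ ^ 2 := by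
    rw [integral_add hE2.integrableOn hE2'.integrableOn,
      integral_comp_neg_Ioi (f := fun x => ‖E x‖ ^ 2), neg_zero, add_comm,
      intervalIntegral.integral_Iic_add_Ioi hE2.integrableOn hE2.integrableOn,
      hE, hhT_plancherel f hf hsupp, setIntegral_eq_integral_of_forall_compl_eq_zero]
    intro t ht
    simp [hz t (by simpa using ht)]
  have hH : ∀ x, ‖halfHartley f x‖ ^ 2 = (2 / π) * ((‖E x‖ ^ 2 + ‖E (-x)‖ ^ 2) / 2 +
      (E x * starRingEnd ℂ (E (-x))).im) := by
    intro x
    rw [halfHartley, hh_int f hint hz, norm_mul, mul_pow, hh_normsq, Complex.norm_real,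
      Real.norm_of_nonneg (Real.sqrt_nonneg _), Real.sq_sqrt (by positivity)]
  have hGim : IntegrableOn (fun x => (E x * starRingEnd ℂ (E (-x))).im) (Ioi 0) := by
    simp only [← hTg]
    exact hG.integrableOn.im
  have hmain : 2 * ∫ x in Ioi (0 : ℝ), ‖f x‖ ^ 2 ≤ ∫ x in Ioi (0 : ℝ), ‖halfHartley f x‖ ^ 2 := by
    simp only [hH]
    have hsum : IntegrableOn (fun x => (‖E x‖ ^ 2 + ‖E (-x)‖ ^ 2) / 2) (Ioi 0) :=
      ((hE2.add hE2').div_const 2).integrableOn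
    rw [integral_const_mul, integral_add hsum hGim,
      integral_div, hP, mul_add]
    have hpi := Real.pi_pos
    have : 2 / π * (2 * π * (∫ x in Ioi (0 : ℝ), ‖f x‖ ^ 2) / 2) =
        2 * ∫ x in Ioi (0 : ℝ), ‖f x‖ ^ 2 := by field_simp
    rw [this]
    have := mul_nonneg (show 0 ≤ 2 / π by positivity) hIm
    linarith
  have h0 : 0 ≤ ∫ x in Ioi (0 : ℝ), ‖f x‖ ^ 2 := integral_nonneg fun x => by positivity
  rw [Real.sqrt_eq_rpow, ← Real.mul_rpow (by norm_num) h0]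
  exact Real.rpow_le_rpow (by positivity) hmain (by norm_num)
end

section
/- For every s ∈ ℂ with Re s = 1/2, the integral ∫₀^∞ (1 − cos t) t^{s−2} dt converges absolutely and equals Γ(s) sin(πs/2)/(1 − s). -/
open MeasureTheory Set Filter
open scoped Real

lemma aux_g_int : IntegrableOn (fun t : ℝ => min 1 t * t ^ (-3/2 : ℝ)) (Ioi 0) := by
  rw [← Ioc_union_Ioi_eq_Ioi (zero_le_one (α := ℝ)), integrableOn_union]
  constructor
  · have : IntegrableOn (fun t : ℝ => t ^ (-1/2 : ℝ)) (Ioc 0 1) := by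
      rw [← intervalIntegrable_iff_integrableOn_Ioc_of_le zero_le_one]
      exact intervalIntegral.intervalIntegrable_rpow' (by norm_num)
    refine this.congr_fun (fun t ht => ?_) measurableSet_Ioc
    simp only
    rw [min_eq_right ht.2, show (-1/2 : ℝ) = 1 + (-3/2) by norm_num, Real.rpow_add ht.1,
      Real.rpow_one]
  · have : IntegrableOn (fun t : ℝ => t ^ (-3/2 : ℝ)) (Ioi 1) :=
      integrableOn_Ioi_rpow_of_lt (by norm_num) one_pos
    refine this.congr_fun (fun t ht => ?_) measurableSet_Ioi
    simp only
    rw [min_eq_left (le_of_lt ht), one_mul]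

lemma aux_exp (w : ℂ) (hw : 0 ≤ w.re) : ‖1 - Complex.exp (-w)‖ ≤ 2 * min 1 ‖w‖ := by
  rcases le_total ‖w‖ 1 with h | h
  · rw [min_eq_right h, norm_sub_rev]
    simpa using Complex.norm_exp_sub_one_le (x := -w) (by simpa using h)
  · rw [min_eq_left h]
    refine (norm_sub_le _ _).trans ?_
    have : ‖Complex.exp (-w)‖ ≤ 1 := by
      rw [Complex.norm_exp]; simpa using hw
    simp only [norm_one]; linarith

lemma aux_exp_t (z : ℂ) (hz : 0 ≤ z.re) (t : ℝ) (ht : 0 < t) :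
    ‖1 - Complex.exp (-(z * t))‖ ≤ 2 * (1 + ‖z‖) * min 1 t := by
  refine (aux_exp (z * t) (by simp; positivity)).trans ?_
  rw [mul_assoc]
  gcongr
  rw [norm_mul, Complex.norm_real, Real.norm_of_nonneg ht.le]
  have h0 := norm_nonneg z
  rcases le_total t 1 with h | h
  · rw [min_eq_right h]
    refine (min_le_right _ _).trans ?_
    nlinarith
  · rw [min_eq_left h]
    refine (min_le_left _ _).trans ?_
    nlinarith

lemma aux_bound (s : ℂ) (hs : s.re = 1 / 2) (z : ℂ) (hz : 0 ≤ z.re) (t : ℝ) (ht : 0 < t) :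
    ‖(1 - Complex.exp (-(z * t))) * (t : ℂ) ^ (s - 2)‖
      ≤ 2 * (1 + ‖z‖) * (min 1 t * t ^ (-3/2 : ℝ)) := by
  rw [norm_mul, Complex.norm_cpow_eq_rpow_re_of_pos ht, ← mul_assoc]
  have : (s - 2).re = -3/2 := by simp [hs]; norm_num
  rw [this]
  gcongr
  exact aux_exp_t z hz t ht

lemma aux_meas (s z : ℂ) : AEStronglyMeasurable
    (fun t : ℝ => (1 - Complex.exp (-(z * t))) * (t : ℂ) ^ (s - 2)) (volume.restrict (Ioi 0)) := by
  refine ContinuousOn.aestronglyMeasurable ?_ measurableSet_Ioi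
  refine ContinuousOn.mul (by fun_prop) ?_
  intro t ht
  exact (Complex.continuousAt_ofReal_cpow_const t _ (Or.inr (ne_of_gt ht))).continuousWithinAt

lemma aux_int (s : ℂ) (hs : s.re = 1 / 2) (z : ℂ) (hz : 0 ≤ z.re) :
    IntegrableOn (fun t : ℝ => (1 - Complex.exp (-(z * t))) * (t : ℂ) ^ (s - 2)) (Ioi 0) := by
  refine (aux_g_int.const_mul (2 * (1 + ‖z‖))).mono' (aux_meas s z) ?_
  filter_upwards [ae_restrict_mem measurableSet_Ioi] with t ht
  exact aux_bound s hs z hz t ht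

/-- The auxiliary transform. -/
noncomputable def auxH (s z : ℂ) : ℂ :=
  ∫ t in Ioi (0 : ℝ), (1 - Complex.exp (-(z * t))) * (t : ℂ) ^ (s - 2)

lemma auxH_one (s : ℂ) (hs : s.re = 1 / 2) : auxH s 1 = Complex.Gamma s / (1 - s) := by
  have hs1 : s - 1 ≠ 0 := by
    intro h
    have := congrArg Complex.re h
    simp [hs] at this
    norm_num at this
  have hs1' : 1 - s ≠ 0 := by
    rw [← neg_sub]; exact neg_ne_zero.mpr hs1
  have hconv := Complex.GammaIntegral_convergent (s := s) (by rw [hs]; norm_num)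
  have hnorm : ∀ t : ℝ, 0 < t → ‖(1 - Complex.exp (-((1:ℂ) * t))) * ((t : ℂ) ^ (s - 1) / (s - 1))‖
      ≤ 4 * (min 1 t * t ^ (-1/2 : ℝ)) * ‖s - 1‖⁻¹ := by
    intro t ht
    have h1 := aux_exp_t 1 (by simp) t ht
    rw [norm_mul, norm_div, Complex.norm_cpow_eq_rpow_re_of_pos ht, div_eq_mul_inv, ← mul_assoc,
      ← mul_assoc]
    have : (s - 1).re = -1/2 := by simp [hs]; norm_num
    rw [this]
    gcongr
    refine h1.trans (le_of_eq ?_)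
    norm_num
  have key := integral_Ioi_mul_deriv_eq_deriv_mul (a := 0) (a' := 0) (b' := 0)
    (u := fun t : ℝ => 1 - Complex.exp (-((1:ℂ) * t)))
    (u' := fun t : ℝ => Complex.exp (-(t:ℂ)))
    (v := fun t : ℝ => (t : ℂ) ^ (s - 1) / (s - 1)) (v' := fun t : ℝ => (t : ℂ) ^ (s - 2))
    ?_ ?_ (aux_int s hs 1 (by simp)) ?_ ?_ ?_
  · unfold auxH
    rw [key, Complex.Gamma_eq_integral (by rw [hs]; norm_num), Complex.GammaIntegral]
    simp_rw [← mul_div_assoc]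
    rw [integral_div]
    push_cast
    field_simp
    ring
  · intro t _
    have h1 : HasDerivAt (fun t : ℝ => (t : ℂ)) 1 t := Complex.ofRealCLM.hasDerivAt
    have := ((h1.const_mul (1:ℂ)).neg.cexp).const_sub 1
    convert! this using 1
    simp
  · intro t ht
    have := hasDerivAt_ofReal_cpow_const' (ne_of_gt ht) (r := s - 2) (by
      intro h; apply hs1; linear_combination h)
    rwa [show s - 2 + 1 = s - 1 by ring] at this
  · have hd : IntegrableOn (fun t : ℝ => (Real.exp (-t) : ℂ) * (t : ℂ) ^ (s - 1) / (s - 1)) (Ioi 0) :=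
      hconv.div_const (s - 1)
    refine hd.congr_fun (fun t ht => ?_) measurableSet_Ioi
    simp [mul_div_assoc]
  · refine squeeze_zero_norm' (a := fun t : ℝ => 4 * (t ^ (1/2 : ℝ)) * ‖s - 1‖⁻¹) ?_ ?_
    · filter_upwards [self_mem_nhdsWithin] with t ht
      have ht : 0 < t := ht
      refine (hnorm t ht).trans ?_
      gcongr
      rw [show (1/2 : ℝ) = 1 + (-1/2) by norm_num, Real.rpow_add ht, Real.rpow_one]
      gcongr
      exact min_le_right _ _
    · have : ContinuousAt (fun t : ℝ => 4 * (t ^ (1/2 : ℝ)) * ‖s - 1‖⁻¹) 0 := by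
        have := Real.continuousAt_rpow_const 0 (1/2) (Or.inr (by norm_num))
        fun_prop
      have h := this.tendsto
      simp at h
      refine (Tendsto.mono_left ?_ nhdsWithin_le_nhds)
      simpa using h
  · refine squeeze_zero_norm' (a := fun t : ℝ => 4 * (t ^ (-(1/2) : ℝ)) * ‖s - 1‖⁻¹) ?_ ?_
    · filter_upwards [eventually_gt_atTop 0] with t ht
      refine (hnorm t ht).trans ?_
      gcongr
      rw [show (-1/2 : ℝ) = -(1/2) by norm_num]
      refine mul_le_of_le_one_left (by positivity) (min_le_left _ _)
    · have := ((tendsto_rpow_neg_atTop (y := 1/2) (by norm_num)).const_mul 4).mul_const ‖s - 1‖⁻¹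
      simpa using this

lemma auxH_real (s : ℂ) (r : ℝ) (hr : 0 < r) : auxH s r = (r : ℂ) ^ (1 - s) * auxH s 1 := by
  have h := integral_comp_mul_left_Ioi
    (fun t : ℝ => (1 - Complex.exp (-((1:ℂ) * t))) * (t : ℂ) ^ (s - 2)) 0 hr
  rw [mul_zero] at h
  have h2 : ∫ x in Ioi (0:ℝ), (1 - Complex.exp (-((1:ℂ) * (r * x : ℝ)))) * ((r * x : ℝ) : ℂ) ^ (s - 2)
      = (r : ℂ) ^ (s - 2) * auxH s r := by
    unfold auxH
    rw [← integral_const_mul]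
    refine setIntegral_congr_fun measurableSet_Ioi (fun t ht => ?_)
    rw [Complex.ofReal_mul, Complex.mul_cpow_ofReal_nonneg hr.le (le_of_lt ht), one_mul]
    ring
  rw [h2] at h
  have hr' : (r : ℂ) ≠ 0 := by exact_mod_cast hr.ne'
  have h3 : (r : ℂ) ^ (2 - s) * (r : ℂ) ^ (s - 2) = 1 := by
    rw [← Complex.cpow_add _ _ hr']; simp
  have h4 : (r : ℂ) ^ (2 - s) = r * (r : ℂ) ^ (1 - s) := by
    rw [show 2 - s = 1 + (1 - s) by ring, Complex.cpow_add _ _ hr', Complex.cpow_one]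
  calc auxH s r = (r : ℂ) ^ (2 - s) * ((r : ℂ) ^ (s - 2) * auxH s r) := by
        rw [← mul_assoc, h3, one_mul]
    _ = _ := by
        rw [h, h4, Complex.real_smul, auxH]
        push_cast
        field_simp

lemma auxH_diff (s : ℂ) (hs : s.re = 1 / 2) (z : ℂ) (hz : 0 < z.re) :
    DifferentiableAt ℂ (auxH s) z := by
  have hmem : {w : ℂ | z.re / 2 < w.re} ∈ nhds z :=
    (isOpen_lt continuous_const Complex.continuous_re).mem_nhds (by simp; linarith)
  have := hasDerivAt_integral_of_dominated_loc_of_deriv_le (μ := volume.restrict (Ioi (0:ℝ)))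
    (F := fun (z : ℂ) (t : ℝ) => (1 - Complex.exp (-(z * t))) * (t : ℂ) ^ (s - 2))
    (F' := fun (z : ℂ) (t : ℝ) => (t * Complex.exp (-(z * t))) * (t : ℂ) ^ (s - 2))
    (bound := fun t : ℝ => t ^ (-1/2 : ℝ) * Real.exp (-(z.re / 2) * t ^ (1 : ℝ)))
    (x₀ := z) hmem (Eventually.of_forall fun w => aux_meas s w) (aux_int s hs z hz.le) ?_ ?_ ?_ ?_
  · exact this.2.differentiableAt
  · refine ContinuousOn.aestronglyMeasurable ?_ measurableSet_Ioi
    refine ContinuousOn.mul (by fun_prop) ?_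
    intro t ht
    exact (Complex.continuousAt_ofReal_cpow_const t _ (Or.inr (ne_of_gt ht))).continuousWithinAt
  · filter_upwards [ae_restrict_mem measurableSet_Ioi] with t ht w hw
    have ht : 0 < t := ht
    have hw : z.re / 2 < w.re := hw
    rw [norm_mul, norm_mul, Complex.norm_cpow_eq_rpow_re_of_pos ht, Complex.norm_exp,
      Complex.norm_real, Real.norm_of_nonneg ht.le]
    have : (s - 2).re = -3/2 := by simp [hs]; norm_num
    rw [this, mul_right_comm, show (-1/2 : ℝ) = 1 + (-3/2) by norm_num, Real.rpow_add ht,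
      Real.rpow_one]
    gcongr
    simp
    gcongr
  · exact integrableOn_rpow_mul_exp_neg_mul_rpow (by norm_num) one_pos (by linarith)
  · filter_upwards with t w _
    have h1 : HasDerivAt (fun w : ℂ => -(w * t)) (-(1 * t)) w :=
      ((hasDerivAt_id w).mul_const (t:ℂ)).neg
    have := ((h1.cexp).const_sub 1).mul_const ((t : ℂ) ^ (s - 2))
    convert! this using 1
    ring

lemma auxH_right (s : ℂ) (hs : s.re = 1 / 2) (z : ℂ) (hz : 0 < z.re) :
    auxH s z = z ^ (1 - s) * auxH s 1 := by
  have hopen : IsOpen {w : ℂ | 0 < w.re} := isOpen_lt continuous_const Complex.continuous_re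
  have hf : AnalyticOnNhd ℂ (auxH s) {w : ℂ | 0 < w.re} :=
    DifferentiableOn.analyticOnNhd
      (fun w hw => (auxH_diff s hs w hw).differentiableWithinAt) hopen
  have hg : AnalyticOnNhd ℂ (fun w => w ^ (1 - s) * auxH s 1) {w : ℂ | 0 < w.re} := by
    refine DifferentiableOn.analyticOnNhd (fun w hw => ?_) hopen
    have : w ∈ Complex.slitPlane := Or.inl hw
    exact ((differentiableAt_id.cpow_const this).mul_const _).differentiableWithinAt
  refine hf.eqOn_of_preconnected_of_frequently_eq hg
    (convex_halfSpace_re_gt 0).isPreconnected (z₀ := 1) (by simp) ?_ hz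
  have ht : Tendsto (fun r : ℝ => (r : ℂ)) (nhdsWithin 1 {1}ᶜ) (nhdsWithin 1 {1}ᶜ) := by
    refine tendsto_nhdsWithin_iff.mpr ⟨?_, ?_⟩
    · exact (Complex.continuous_ofReal.tendsto' 1 1 (by simp)).mono_left nhdsWithin_le_nhds
    · filter_upwards [self_mem_nhdsWithin] with r hr
      simpa using hr
  refine ht.frequently (Eventually.frequently ?_)
  filter_upwards [nhdsWithin_le_nhds (lt_mem_nhds (zero_lt_one (α := ℝ)))] with r hr
  exact auxH_real s r hr

lemma auxH_bdry (s : ℂ) (hs : s.re = 1 / 2) (z : ℂ) (hz : z.re = 0) (hz' : z ∈ Complex.slitPlane) :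
    auxH s z = z ^ (1 - s) * auxH s 1 := by
  have hpath : Tendsto (fun ε : ℝ => z + ε) (nhdsWithin 0 (Ioi 0)) (nhds z) := by
    have : Continuous (fun ε : ℝ => z + ε) := by fun_prop
    exact (this.tendsto' 0 z (by simp)).mono_left nhdsWithin_le_nhds
  have hsmall : ∀ᶠ ε : ℝ in nhdsWithin 0 (Ioi 0), ε < 1 :=
    nhdsWithin_le_nhds (gt_mem_nhds zero_lt_one)
  have h1 : Tendsto (fun ε : ℝ => auxH s (z + ε)) (nhdsWithin 0 (Ioi 0)) (nhds (auxH s z)) := by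
    refine tendsto_integral_filter_of_dominated_convergence
      (fun t => 2 * (1 + (‖z‖ + 1)) * (min 1 t * t ^ (-3/2 : ℝ)))
      (Eventually.of_forall fun ε => aux_meas s _) ?_ (aux_g_int.const_mul _) ?_
    · filter_upwards [self_mem_nhdsWithin, hsmall] with ε hε hε1
      have hε : 0 < ε := hε
      filter_upwards [ae_restrict_mem measurableSet_Ioi] with t ht
      have ht : 0 < t := ht
      refine (aux_bound s hs (z + ε) (by simp [hz, hε.le]) t ht).trans ?_
      have hm : 0 ≤ min 1 t * t ^ (-3/2 : ℝ) :=
        mul_nonneg (le_min zero_le_one ht.le) (by positivity)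
      gcongr
      refine (norm_add_le _ _).trans ?_
      rw [Complex.norm_real, Real.norm_of_nonneg hε.le]
      gcongr
    · filter_upwards with t
      have : Continuous (fun w : ℂ => (1 - Complex.exp (-(w * t))) * (t : ℂ) ^ (s - 2)) := by
        fun_prop
      exact (this.tendsto z).comp hpath
  have h2 : Tendsto (fun ε : ℝ => auxH s (z + ε)) (nhdsWithin 0 (Ioi 0))
      (nhds (z ^ (1 - s) * auxH s 1)) := by
    have hc : ContinuousAt (fun w : ℂ => w ^ (1 - s) * auxH s 1) z :=
      (continuousAt_id.cpow continuousAt_const hz').mul continuousAt_const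
    refine (hc.tendsto.comp hpath).congr' ?_
    filter_upwards [self_mem_nhdsWithin] with ε hε
    have hε : 0 < ε := hε
    exact (auxH_right s hs (z + ε) (by simp [hz, hε])).symm
  exact tendsto_nhds_unique h1 h2

/-- Mellin transform of `(1 - cos t)/t` on the critical line: the integral
`∫₀^∞ (1 - cos t) t^{s-2} dt` converges absolutely and equals `Γ(s) sin(πs/2)/(1-s)`. -/
theorem mellin_one_sub_cos_div_self (s : ℂ) (hs : s.re = 1 / 2) :
    IntegrableOn (fun t : ℝ => ((1 - Real.cos t : ℝ) : ℂ) * (t : ℂ) ^ (s - 2)) (Ioi 0) ∧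
      ∫ t in Ioi (0 : ℝ), ((1 - Real.cos t : ℝ) : ℂ) * (t : ℂ) ^ (s - 2) =
        Complex.Gamma s * Complex.sin (π * s / 2) / (1 - s) := by
  have hfun : (fun t : ℝ => ((1 - Real.cos t : ℝ) : ℂ) * (t : ℂ) ^ (s - 2)) =
      fun t : ℝ => ((1 - Complex.exp (-(Complex.I * t))) * (t : ℂ) ^ (s - 2)
        + (1 - Complex.exp (-(-Complex.I * t))) * (t : ℂ) ^ (s - 2)) / 2 := by
    funext t
    push_cast
    rw [Complex.cos, show -(Complex.I * (t:ℂ)) = -t * Complex.I by ring,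
      show -(-Complex.I * (t:ℂ)) = t * Complex.I by ring]
    ring
  have i1 := aux_int s hs Complex.I (by simp)
  have i2 := aux_int s hs (-Complex.I) (by simp)
  rw [hfun]
  refine ⟨(i1.add i2).div_const 2, ?_⟩
  rw [integral_div, integral_add i1 i2]
  have e1 := auxH_bdry s hs Complex.I (by simp) (by simp [Complex.mem_slitPlane_iff])
  have e2 := auxH_bdry s hs (-Complex.I) (by simp) (by simp [Complex.mem_slitPlane_iff])
  rw [auxH_one s hs] at e1 e2
  unfold auxH at e1 e2
  rw [e1, e2, Complex.cpow_def_of_ne_zero Complex.I_ne_zero,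
    Complex.cpow_def_of_ne_zero (neg_ne_zero.mpr Complex.I_ne_zero), Complex.log_I,
    Complex.log_neg_I]
  have : Complex.sin (π * s / 2) = Complex.cos (π / 2 * (1 - s)) := by
    rw [← Complex.cos_pi_div_two_sub]; congr 1; ring
  rw [this, Complex.cos,
    show (π / 2 * Complex.I * (1 - s) : ℂ) = π / 2 * (1 - s) * Complex.I by ring,
    show (-(π / 2) * Complex.I * (1 - s) : ℂ) = -(π / 2 * (1 - s)) * Complex.I by ring]
  ring
end
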